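/- External inlinks: assume I and Ī are nonempty and min_{i ∈ I} v_i > max_{j ∈ Ī} v_j. Then for every node j ∈ Ī that is not a parent of I (i.e. there is no ℓ ∈ I with (j,ℓ) ∈ E) and for every i ∈ I, the graph with edge set Ẽ = E ∪ {(j,i)} satisfies π̃^T e_I > π^T e_I. -/

import Mathlib

open Matrix Finset

/-- Outdegree of node `i` in the edge set `E`. -/
def outdeg {n : ℕ} (E : Finset (Fin n × Fin n)) (i : Fin n) : ℕ :=
  (Finset.univ.filter (fun j => (i, j) ∈ E)).card

/-- The scaled adjacency matrix `P` of the graph: `P i j = 1 / outdeg i` if `(i,j) ∈ E`. -/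
noncomputable def Pmat {n : ℕ} (E : Finset (Fin n × Fin n)) : Matrix (Fin n) (Fin n) ℝ :=
  fun i j => if (i, j) ∈ E then ((outdeg E i : ℝ))⁻¹ else 0

/-- Indicator vector of a set of nodes. -/
def ind {n : ℕ} (I : Finset (Fin n)) : Fin n → ℝ :=
  fun i => if i ∈ I then 1 else 0

/-- `v = (Id - cP)⁻¹ e_I`, the vector of mean numbers of visits to `I` before zapping. -/
noncomputable def vvec {n : ℕ} (c : ℝ) (E : Finset (Fin n × Fin n)) (I : Finset (Fin n)) : Fin n → ℝ :=
  (1 - c • Pmat E)⁻¹ *ᵥ ind I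

/-- PageRank vector `πᵀ = (1-c) zᵀ (Id - cP)⁻¹`. -/
noncomputable def pr {n : ℕ} (c : ℝ) (z : Fin n → ℝ) (E : Finset (Fin n × Fin n)) : Fin n → ℝ :=
  (1 - c) • (((1 - c • Pmat E)⁻¹)ᵀ *ᵥ z)

/-- PageRank of the set `I`: `πᵀ e_I`. -/
noncomputable def prSet {n : ℕ} (c : ℝ) (z : Fin n → ℝ) (E : Finset (Fin n × Fin n))
    (I : Finset (Fin n)) : ℝ :=
  ∑ i ∈ I, pr c z E i

/-- Node `i` has access to (some node of) the set `J`: `i ∈ J` or a directed path from `i`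
reaches `J`. -/
def access {n : ℕ} (E : Finset (Fin n × Fin n)) (i : Fin n) (J : Finset (Fin n)) : Prop :=
  ∃ j ∈ J, Relation.ReflTransGen (fun a b => (a, b) ∈ E) i j

lemma Pmat_nonneg' {n : ℕ} (E : Finset (Fin n × Fin n)) (a b : Fin n) : 0 ≤ Pmat E a b := by
  unfold Pmat; split_ifs <;> positivity

lemma Pmat_mulVec {n : ℕ} (E : Finset (Fin n × Fin n)) (u : Fin n → ℝ) (a : Fin n) :
    (Pmat E *ᵥ u) a = (outdeg E a : ℝ)⁻¹ * ∑ b ∈ univ.filter (fun b => (a, b) ∈ E), u b := by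
  simp only [Matrix.mulVec, dotProduct, Pmat, ite_mul, zero_mul]
  rw [← Finset.sum_filter, Finset.mul_sum]

lemma max_principle {n : ℕ} (E : Finset (Fin n × Fin n))
    (hE : ∀ i, 0 < outdeg E i) (c : ℝ) (hc0 : 0 < c) (hc1 : c < 1) (u : Fin n → ℝ)
    (h : ∀ a, 0 ≤ u a - c * (Pmat E *ᵥ u) a) (a : Fin n) : 0 ≤ u a := by
  obtain ⟨m, -, hm⟩ := Finset.exists_min_image univ u ⟨a, mem_univ a⟩
  have h1 : u m ≤ (Pmat E *ᵥ u) m := by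
    rw [Pmat_mulVec]
    have hd : (0 : ℝ) < outdeg E m := by exact_mod_cast hE m
    rw [inv_mul_eq_div, le_div_iff₀ hd]
    have := Finset.card_nsmul_le_sum (univ.filter (fun b => (m, b) ∈ E)) u (u m)
      (fun x _ => hm x (mem_univ x))
    rw [nsmul_eq_mul] at this
    unfold outdeg
    linarith
  have h2 := h m
  have h3 := hm a (mem_univ a)
  nlinarith

lemma isUnit_mat {n : ℕ} (E : Finset (Fin n × Fin n))
    (hE : ∀ i, 0 < outdeg E i) (c : ℝ) (hc0 : 0 < c) (hc1 : c < 1) :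
    IsUnit (1 - c • Pmat E) := by
  rw [← Matrix.mulVec_injective_iff_isUnit]
  intro x y hxy
  have hxy' : ∀ a, x a - c * (Pmat E *ᵥ x) a = y a - c * (Pmat E *ᵥ y) a := by
    intro a
    have := congrFun hxy a
    simpa [Matrix.sub_mulVec, Matrix.smul_mulVec] using this
  funext a
  have h1 := max_principle E hE c hc0 hc1 (x - y) (fun a => by
    rw [Matrix.mulVec_sub]; simp only [Pi.sub_apply]; linarith [hxy' a]) a
  have h2 := max_principle E hE c hc0 hc1 (y - x) (fun a => by
    rw [Matrix.mulVec_sub]; simp only [Pi.sub_apply]; linarith [hxy' a]) a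
  simp only [Pi.sub_apply] at h1 h2
  linarith

lemma vvec_eq {n : ℕ} (E : Finset (Fin n × Fin n))
    (hE : ∀ i, 0 < outdeg E i) (c : ℝ) (hc0 : 0 < c) (hc1 : c < 1) (I : Finset (Fin n))
    (a : Fin n) : vvec c E I a - c * (Pmat E *ᵥ vvec c E I) a = ind I a := by
  have hu := isUnit_mat E hE c hc0 hc1
  have : (1 - c • Pmat E) *ᵥ vvec c E I = ind I := by
    unfold vvec
    rw [Matrix.mulVec_mulVec, Matrix.mul_nonsing_inv _ ((Matrix.isUnit_iff_isUnit_det _).1 hu),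
      Matrix.one_mulVec]
  have := congrFun this a
  simpa [Matrix.sub_mulVec, Matrix.smul_mulVec] using this

lemma prSet_eq {n : ℕ} (c : ℝ) (z : Fin n → ℝ) (E : Finset (Fin n × Fin n))
    (I : Finset (Fin n)) : prSet c z E I = (1 - c) * ∑ k, z k * vvec c E I k := by
  have h1 : prSet c z E I = pr c z E ⬝ᵥ ind I := by
    simp [prSet, dotProduct, ind]
  rw [h1]
  unfold pr
  rw [smul_dotProduct, Matrix.mulVec_transpose, ← Matrix.dotProduct_mulVec]
  rfl

/-- Theorem 18 (External inlinks): if `min_{i ∈ I} v i > max_{j ∉ I} v j`, then adding a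
link `(j, i)` from any non-parent `j` of `I` to any `i ∈ I` strictly increases the
PageRank of `I`. -/
theorem stmt19 {n : ℕ} (hn : 1 ≤ n) (E : Finset (Fin n × Fin n))
    (hE : ∀ i, 0 < outdeg E i) (c : ℝ) (hc0 : 0 < c) (hc1 : c < 1)
    (z : Fin n → ℝ) (hz : ∀ i, 0 < z i) (hz1 : ∑ i, z i = 1)
    (I : Finset (Fin n)) (hI : I.Nonempty) (hIc : (Iᶜ : Finset (Fin n)).Nonempty)
    (hmin : ∀ i ∈ I, ∀ j, j ∉ I → vvec c E I j < vvec c E I i)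
    (j : Fin n) (hj : j ∉ I) (hjnp : ¬ ∃ ℓ ∈ I, (j, ℓ) ∈ E)
    (i : Fin n) (hi : i ∈ I) :
    prSet c z E I < prSet c z (insert (j, i) E) I := by
  have hji : (j, i) ∉ E := fun h => hjnp ⟨i, hi, h⟩
  have hne : ∀ a, a ≠ j → univ.filter (fun b => (a, b) ∈ insert (j, i) E)
      = univ.filter (fun b => (a, b) ∈ E) := by
    intro a ha
    ext b
    simp [ha]
  have heq : univ.filter (fun b => (j, b) ∈ insert (j, i) E)
      = insert i (univ.filter (fun b => (j, b) ∈ E)) := by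
    ext b
    simp
  have hinot : i ∉ univ.filter (fun b => (j, b) ∈ E) := by simpa using hji
  have hdj : outdeg (insert (j, i) E) j = outdeg E j + 1 := by
    unfold outdeg
    rw [heq, Finset.card_insert_of_notMem hinot]
  have hdne : ∀ a, a ≠ j → outdeg (insert (j, i) E) a = outdeg E a := by
    intro a ha
    unfold outdeg
    rw [hne a ha]
  have hE' : ∀ a, 0 < outdeg (insert (j, i) E) a := by
    intro a
    by_cases ha : a = j
    · rw [ha, hdj]; omega
    · rw [hdne a ha]; exact hE a
  set v := vvec c E I with hv
  set w := vvec c (insert (j, i) E) I with hw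
  have hve := vvec_eq E hE c hc0 hc1 I
  have hwe := vvec_eq (insert (j, i) E) hE' c hc0 hc1 I
  rw [← hv] at hve
  rw [← hw] at hwe
  have hPne : ∀ a, a ≠ j → (Pmat (insert (j, i) E) *ᵥ v) a = (Pmat E *ᵥ v) a := by
    intro a ha
    rw [Pmat_mulVec, Pmat_mulVec, hne a ha, hdne a ha]
  have hPj : (Pmat E *ᵥ v) j < (Pmat (insert (j, i) E) *ᵥ v) j := by
    rw [Pmat_mulVec, Pmat_mulVec, heq, hdj, Finset.sum_insert hinot]
    have hd : (0 : ℝ) < outdeg E j := by exact_mod_cast hE j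
    have hs : ∑ b ∈ univ.filter (fun b => (j, b) ∈ E), v b < outdeg E j * v i := by
      have : ∑ b ∈ univ.filter (fun b => (j, b) ∈ E), v b
          < ∑ b ∈ univ.filter (fun b => (j, b) ∈ E), v i := by
        apply Finset.sum_lt_sum_of_nonempty
        · exact Finset.card_pos.1 (hE j)
        · intro b hb
          apply hmin i hi b
          intro hbI
          exact hjnp ⟨b, hbI, by simpa using hb⟩
      rw [Finset.sum_const, nsmul_eq_mul] at this
      exact this
    push_cast
    rw [inv_mul_eq_div, inv_mul_eq_div, div_lt_div_iff₀ hd (by positivity)]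
    nlinarith
  have hdiff : ∀ a, (w - v) a - c * (Pmat (insert (j, i) E) *ᵥ (w - v)) a
      = c * ((Pmat (insert (j, i) E) *ᵥ v) a - (Pmat E *ᵥ v) a) := by
    intro a
    rw [Matrix.mulVec_sub]
    simp only [Pi.sub_apply]
    linarith [hve a, hwe a]
  have hnn : ∀ a, 0 ≤ (w - v) a := by
    apply max_principle _ hE' c hc0 hc1
    intro a
    rw [hdiff]
    by_cases ha : a = j
    · rw [ha]
      exact mul_nonneg hc0.le (sub_nonneg.2 hPj.le)
    · rw [hPne a ha]; simp
  have hpos : 0 < (w - v) j := by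
    have h1 := hdiff j
    have h2 : 0 ≤ (Pmat (insert (j, i) E) *ᵥ (w - v)) j := by
      unfold Matrix.mulVec dotProduct
      exact Finset.sum_nonneg fun b _ => mul_nonneg (Pmat_nonneg' _ _ _) (hnn b)
    have h3 := mul_pos hc0 (sub_pos.2 hPj)
    have h4 := mul_nonneg hc0.le h2
    linarith
  rw [prSet_eq, prSet_eq, ← hv, ← hw]
  apply mul_lt_mul_of_pos_left _ (sub_pos.2 hc1)
  apply Finset.sum_lt_sum
  · intro a _
    exact mul_le_mul_of_nonneg_left (by simpa using hnn a) (hz a).le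
  · exact ⟨j, mem_univ j, mul_lt_mul_of_pos_left (by simpa using hpos) (hz j)⟩
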